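/- The series ∑_{k=1}^∞ h_k³/k⁴ converges and equals (93/4)·ζ(2)·ζ(5) - (945/32)·ζ(3)·ζ(4). -/

import Mathlib

open Finset Real

noncomputable def H (k : ℕ) : ℝ := ∑ j ∈ Finset.range k, (1 : ℝ) / ((j : ℝ) + 1)
noncomputable def H2 (k : ℕ) : ℝ := ∑ j ∈ Finset.range k, (1 : ℝ) / ((j : ℝ) + 1) ^ 2
noncomputable def H3 (k : ℕ) : ℝ := ∑ j ∈ Finset.range k, (1 : ℝ) / ((j : ℝ) + 1) ^ 3
noncomputable def h (k : ℕ) : ℝ := ∑ j ∈ Finset.range k, (1 : ℝ) / (2 * (j : ℝ) + 1)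
noncomputable def h2 (k : ℕ) : ℝ := ∑ j ∈ Finset.range k, (1 : ℝ) / (2 * (j : ℝ) + 1) ^ 2
noncomputable def h3 (k : ℕ) : ℝ := ∑ j ∈ Finset.range k, (1 : ℝ) / (2 * (j : ℝ) + 1) ^ 3
noncomputable def zeta (s : ℕ) : ℝ := ∑' n : ℕ, (1 : ℝ) / ((n : ℝ) + 1) ^ s

/-- The positive half-integers `n + 1/2`. -/
noncomputable def halfInt (n : ℕ) : ℝ := (n : ℝ) + 1 / 2

lemma halfInt_pos (n : ℕ) : 0 < halfInt n := by
  unfold halfInt; positivity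

lemma halfInt_ne_zero (n : ℕ) : halfInt n ≠ 0 := (halfInt_pos n).ne'

lemma half_le_halfInt (n : ℕ) : 1 / 2 ≤ halfInt n := by
  unfold halfInt; linarith [Nat.cast_nonneg (α := ℝ) n]

lemma halfInt_injective : Function.Injective halfInt := by
  intro m n hmn
  simpa [halfInt] using hmn

lemma int_sub_halfInt_ne_zero (k : ℤ) (n : ℕ) : (k : ℝ) - halfInt n ≠ 0 := by
  unfold halfInt
  intro hk
  have h2 : ((2 * k - 2 * n - 1 : ℤ) : ℝ) = 0 := by push_cast; linarith
  have h3 : (2 * k - 2 * n - 1 : ℤ) = 0 := by exact_mod_cast h2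
  omega

lemma summable_zeta {m : ℕ} (hm : 2 ≤ m) : Summable fun n : ℕ => (1 : ℝ) / ((n : ℝ) + 1) ^ m := by
  have := (summable_nat_add_iff 1).mpr (Real.summable_one_div_nat_pow.mpr (show 1 < m by omega))
  simpa using this

lemma hasSum_zeta {m : ℕ} (hm : 2 ≤ m) :
    HasSum (fun n : ℕ => (1 : ℝ) / ((n : ℝ) + 1) ^ m) (zeta m) :=
  (summable_zeta hm).hasSum

lemma zeta_two : zeta 2 = π ^ 2 / 6 := by
  have h1 := (hasSum_nat_add_iff' 1).mpr hasSum_zeta_two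
  simp only [Nat.cast_add, Nat.cast_one, Finset.sum_range_one, Nat.cast_zero] at h1
  simpa using (hasSum_zeta le_rfl).unique h1

lemma zeta_four : zeta 4 = π ^ 4 / 90 := by
  have h1 := (hasSum_nat_add_iff' 1).mpr hasSum_zeta_four
  simp only [Nat.cast_add, Nat.cast_one, Finset.sum_range_one, Nat.cast_zero] at h1
  simpa using (hasSum_zeta (by norm_num)).unique h1

/-- Power sums over the positive half-integers. -/
lemma hasSum_inv_halfInt_pow {m : ℕ} (hm : 2 ≤ m) :
    HasSum (fun n : ℕ => (halfInt n)⁻¹ ^ m) ((2 ^ m - 1) * zeta m) := by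
  have hz := hasSum_zeta hm
  have hodd : HasSum (fun n : ℕ => (1 : ℝ) / (((2 * n + 1 : ℕ) : ℝ) + 1) ^ m)
      ((2 ^ m)⁻¹ * zeta m) := by
    refine (hz.mul_left ((2 : ℝ) ^ m)⁻¹).congr_fun ?_
    intro n
    push_cast
    rw [show (2 * (n : ℝ) + 1 + 1) = 2 * (n + 1) by ring, mul_pow]
    field_simp
  have heven : Summable fun n : ℕ => (1 : ℝ) / (((2 * n : ℕ) : ℝ) + 1) ^ m :=
    hz.summable.comp_injective (i := fun n : ℕ => 2 * n) (fun a b hab => by simpa using hab)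
  have hsum := (HasSum.even_add_odd (f := fun n : ℕ => (1 : ℝ) / ((n : ℝ) + 1) ^ m)
    heven.hasSum hodd).unique hz
  have h1 := heven.hasSum.mul_left ((2 : ℝ) ^ m)
  have h2 : ∑' n : ℕ, (1 : ℝ) / (((2 * n : ℕ) : ℝ) + 1) ^ m = zeta m - (2 ^ m)⁻¹ * zeta m := by
    linarith
  rw [h2] at h1
  have h3 : (2 : ℝ) ^ m * (zeta m - (2 ^ m)⁻¹ * zeta m) = (2 ^ m - 1) * zeta m := by
    field_simp
  rw [h3] at h1
  refine h1.congr_fun ?_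
  intro n
  have : halfInt n = (2 * n + 1) / 2 := by unfold halfInt; ring
  rw [this]
  push_cast
  rw [inv_div, div_pow]
  ring

lemma hasSum_inv_int_sub_halfInt_sq (n : ℕ) :
    HasSum (fun k : ℤ => ((k : ℝ) - halfInt n)⁻¹ ^ 2) (π ^ 2) := by
  have h0 := hasSum_inv_halfInt_pow (m := 2) le_rfl
  rw [zeta_two] at h0
  have h1 : HasSum (fun k : ℤ => ((k : ℝ) + 1 / 2)⁻¹ ^ 2) (π ^ 2) := by
    rw [show π ^ 2 = (2 ^ 2 - 1) * (π ^ 2 / 6) + (2 ^ 2 - 1) * (π ^ 2 / 6) by ring]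
    refine HasSum.of_nat_of_neg_add_one (by simpa [halfInt] using h0) ?_
    refine h0.congr_fun fun k => ?_
    push_cast [halfInt]
    rw [show (-((k : ℝ) + 1) + 1 / 2) = -(k + 1 / 2) by ring, inv_neg, neg_sq]
  have h2 := (Equiv.addRight (-(n : ℤ) - 1)).hasSum_iff.mpr h1
  refine h2.congr_fun fun k => ?_
  simp only [Function.comp, Equiv.coe_addRight, halfInt]
  push_cast
  ring_nf

lemma hasSum_inv_int_sub_halfInt_cube (n : ℕ) :
    HasSum (fun k : ℤ => ((k : ℝ) - halfInt n)⁻¹ ^ 3) 0 := by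
  have h0 := hasSum_inv_halfInt_pow (m := 3) (by norm_num)
  have h1 : HasSum (fun k : ℤ => ((k : ℝ) + 1 / 2)⁻¹ ^ 3) 0 := by
    rw [← add_neg_cancel ((2 ^ 3 - 1) * zeta 3)]
    refine HasSum.of_nat_of_neg_add_one (by simpa [halfInt] using h0) ?_
    refine h0.neg.congr_fun fun k => ?_
    push_cast [halfInt]
    rw [show (-((k : ℝ) + 1) + 1 / 2) = -(k + 1 / 2) by ring, inv_neg]
    ring
  have h2 := (Equiv.addRight (-(n : ℤ) - 1)).hasSum_iff.mpr h1
  refine h2.congr_fun fun k => ?_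
  simp only [Function.comp, Equiv.coe_addRight, halfInt]
  push_cast
  ring_nf

lemma summable_mul_of_summable_sq {ι : Type*} {f g : ι → ℝ} (hf : Summable fun i => f i ^ 2)
    (hg : Summable fun i => g i ^ 2) : Summable fun i => f i * g i := by
  refine Summable.of_norm_bounded (hf.add hg) fun i => ?_
  rw [Real.norm_eq_abs, abs_mul, ← sq_abs (f i), ← sq_abs (g i)]
  nlinarith [sq_nonneg (|f i| - |g i|), sq_nonneg (|f i|), sq_nonneg (|g i|)]

lemma summable_inv_int_sq : Summable fun k : ℤ => ((k : ℝ)⁻¹) ^ 2 := by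
  simpa using Real.summable_one_div_int_pow.mpr (show 1 < 2 by norm_num)

lemma hasSum_inv_int_mul_inv_sub_halfInt (n : ℕ) :
    HasSum (fun k : ℤ => (k : ℝ)⁻¹ * ((k : ℝ) - halfInt n)⁻¹) ((halfInt n)⁻¹ ^ 2) := by
  have hs := summable_mul_of_summable_sq summable_inv_int_sq
    (hasSum_inv_int_sub_halfInt_sq n).summable
  obtain ⟨S, hS⟩ := hs
  have hnat := hS.nat_add_neg
  simp only [Int.cast_zero, inv_zero, zero_mul, add_zero] at hnat
  have hnat' := (hasSum_nat_add_iff' 1).mpr hnat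
  simp only [Finset.sum_range_one, Nat.cast_zero, Int.cast_zero, neg_zero, inv_zero, zero_mul,
    add_zero, sub_zero] at hnat'
  have ha : ((halfInt n : ℝ) : ℂ) ∈ Complex.integerComplement := by
    rintro ⟨k, hk⟩
    exact int_sub_halfInt_ne_zero k n (by rw [sub_eq_zero]; exact_mod_cast hk)
  have hcot := cot_series_rep' ha
  have hc0 : Complex.cot (π * ((halfInt n : ℝ) : ℂ)) = 0 := by
    rw [Complex.cot_eq_cos_div_sin, ← Complex.ofReal_mul, ← Complex.ofReal_cos]
    have : Real.cos (π * halfInt n) = 0 := by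
      rw [Real.cos_eq_zero_iff]
      exact ⟨n, by unfold halfInt; push_cast; ring⟩
    rw [this]; simp
  rw [hc0] at hcot
  have hval : HasSum (fun j : ℕ => (1 / (halfInt n - (j + 1)) + 1 / (halfInt n + (j + 1))))
      (-halfInt n * S) := by
    refine (hnat'.mul_left (-halfInt n)).congr_fun fun j => ?_
    have h1 := int_sub_halfInt_ne_zero (j + 1) n
    have h2 := int_sub_halfInt_ne_zero (-(j + 1)) n
    have h3 : (j : ℝ) + 1 ≠ 0 := by positivity
    push_cast at h1 h2 ⊢
    have h4 : halfInt n - (j + 1) ≠ 0 := fun h => h1 (by linarith)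
    have h5 : halfInt n + (j + 1) ≠ 0 := fun h => h2 (by linarith)
    field_simp
    ring
  have hc := (Complex.hasSum_ofReal.mpr hval).tsum_eq
  push_cast at hc
  rw [hc] at hcot
  have hreal : π * 0 - 1 / halfInt n = -halfInt n * S := by exact_mod_cast hcot
  have : S = (halfInt n)⁻¹ ^ 2 := by
    have := halfInt_ne_zero n
    field_simp at hreal ⊢
    linarith
  rwa [← this]

lemma hasSum_inv_int_sub_halfInt_sub_inv (n : ℕ) :
    HasSum (fun k : ℤ => ((k : ℝ) - halfInt n)⁻¹ - (k : ℝ)⁻¹) 0 := by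
  have h0 := ((hasSum_inv_int_mul_inv_sub_halfInt n).mul_left (halfInt n)).add
    (hasSum_ite_eq (0 : ℤ) (-(halfInt n)⁻¹))
  have ha := halfInt_ne_zero n
  rw [show halfInt n * (halfInt n)⁻¹ ^ 2 + -(halfInt n)⁻¹ = 0 by field_simp; ring] at h0
  refine h0.congr_fun fun k => ?_
  have hk := int_sub_halfInt_ne_zero k n
  split_ifs with h
  · subst h; simp
  · have h' : (k : ℝ) ≠ 0 := by exact_mod_cast h
    field_simp
    ring

lemma halfInt_sub_ne_zero {m n : ℕ} (hmn : m ≠ n) : halfInt m - halfInt n ≠ 0 :=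
  sub_ne_zero.mpr (halfInt_injective.ne hmn)

lemma inv_mul_inv_int_sub_halfInt (k : ℤ) {m n : ℕ} (hmn : m ≠ n) :
    ((k : ℝ) - halfInt m)⁻¹ * ((k : ℝ) - halfInt n)⁻¹ =
      (halfInt m - halfInt n)⁻¹ * (((k : ℝ) - halfInt m)⁻¹ - ((k : ℝ) - halfInt n)⁻¹) := by
  have h1 := int_sub_halfInt_ne_zero k m
  have h2 := int_sub_halfInt_ne_zero k n
  have h3 := halfInt_sub_ne_zero hmn
  field_simp
  ring

/-- Orthogonality of the Cauchy kernels `1 / (k - a)` at positive half-integers. -/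
lemma hasSum_inv_int_sub_halfInt_mul (m n : ℕ) :
    HasSum (fun k : ℤ => ((k : ℝ) - halfInt m)⁻¹ * ((k : ℝ) - halfInt n)⁻¹)
      (if m = n then π ^ 2 else 0) := by
  split_ifs with h
  · subst h
    exact (hasSum_inv_int_sub_halfInt_sq m).congr_fun fun k => by ring
  · have h0 := ((hasSum_inv_int_sub_halfInt_sub_inv m).sub
      (hasSum_inv_int_sub_halfInt_sub_inv n)).mul_left (halfInt m - halfInt n)⁻¹
    simp only [sub_zero, mul_zero] at h0
    refine h0.congr_fun fun k => ?_
    rw [inv_mul_inv_int_sub_halfInt k h]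
    ring

lemma inv_int_mul_inv_sub_halfInt (k : ℤ) (n : ℕ) :
    (k : ℝ)⁻¹ * ((k : ℝ) - halfInt n)⁻¹ =
      (halfInt n)⁻¹ * (((k : ℝ) - halfInt n)⁻¹ - (k : ℝ)⁻¹) +
        if k = 0 then (halfInt n)⁻¹ ^ 2 else 0 := by
  have ha := halfInt_ne_zero n
  have hk := int_sub_halfInt_ne_zero k n
  split_ifs with h
  · subst h; simp; ring
  · have h' : (k : ℝ) ≠ 0 := by exact_mod_cast h
    field_simp
    ring

lemma hasSum_inv_int_mul_two (m n : ℕ) :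
    HasSum (fun k : ℤ => (k : ℝ)⁻¹ * (((k : ℝ) - halfInt m)⁻¹ * ((k : ℝ) - halfInt n)⁻¹))
      ((halfInt m)⁻¹ * ((if m = n then π ^ 2 else 0) - (halfInt n)⁻¹ ^ 2) -
        (halfInt m)⁻¹ ^ 2 * (halfInt n)⁻¹) := by
  have h0 := (((hasSum_inv_int_sub_halfInt_mul m n).sub
    (hasSum_inv_int_mul_inv_sub_halfInt n)).mul_left (halfInt m)⁻¹).add
    (hasSum_ite_eq (0 : ℤ) (-((halfInt m)⁻¹ ^ 2 * (halfInt n)⁻¹)))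
  rw [← sub_eq_add_neg] at h0
  refine h0.congr_fun fun k => ?_
  rw [← mul_assoc, inv_int_mul_inv_sub_halfInt]
  split_ifs with h
  · subst h; simp; ring
  · ring

lemma hasSum_inv_int_sub_halfInt_mul_three {l m : ℕ} (hlm : l ≠ m) (n : ℕ) :
    HasSum (fun k : ℤ => ((k : ℝ) - halfInt l)⁻¹ *
        (((k : ℝ) - halfInt m)⁻¹ * ((k : ℝ) - halfInt n)⁻¹))
      ((halfInt l - halfInt m)⁻¹ *
        ((if l = n then π ^ 2 else 0) - (if m = n then π ^ 2 else 0))) := by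
  refine (((hasSum_inv_int_sub_halfInt_mul l n).sub
    (hasSum_inv_int_sub_halfInt_mul m n)).mul_left _).congr_fun fun k => ?_
  rw [← mul_assoc, inv_mul_inv_int_sub_halfInt k hlm]
  ring

lemma hasSum_inv_int_mul_three_of_hasSum {l m n : ℕ} {t : ℝ}
    (ht : HasSum (fun k : ℤ => ((k : ℝ) - halfInt l)⁻¹ *
        (((k : ℝ) - halfInt m)⁻¹ * ((k : ℝ) - halfInt n)⁻¹)) t) :
    HasSum (fun k : ℤ => (k : ℝ)⁻¹ * (((k : ℝ) - halfInt l)⁻¹ *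
        (((k : ℝ) - halfInt m)⁻¹ * ((k : ℝ) - halfInt n)⁻¹)))
      ((halfInt l)⁻¹ * (t - ((halfInt m)⁻¹ * ((if m = n then π ^ 2 else 0) - (halfInt n)⁻¹ ^ 2) -
        (halfInt m)⁻¹ ^ 2 * (halfInt n)⁻¹)) +
        (halfInt l)⁻¹ ^ 2 * ((halfInt m)⁻¹ * (halfInt n)⁻¹)) := by
  have h0 := ((ht.sub (hasSum_inv_int_mul_two m n)).mul_left (halfInt l)⁻¹).add
    (hasSum_ite_eq (0 : ℤ) ((halfInt l)⁻¹ ^ 2 * ((halfInt m)⁻¹ * (halfInt n)⁻¹)))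
  refine h0.congr_fun fun k => ?_
  rw [← mul_assoc, inv_int_mul_inv_sub_halfInt]
  split_ifs with h
  · subst h; simp; ring
  · ring

/-- The contribution to the quadruple sum of coinciding half-integers. -/
noncomputable def pairTerm (m n : ℕ) : ℝ := (halfInt m)⁻¹ * (halfInt m - halfInt n)⁻¹

lemma hasSum_inv_int_mul_three (l m n : ℕ) :
    HasSum (fun k : ℤ => (k : ℝ)⁻¹ * (((k : ℝ) - halfInt l)⁻¹ *
        (((k : ℝ) - halfInt m)⁻¹ * ((k : ℝ) - halfInt n)⁻¹)))
      ((halfInt l)⁻¹ * ((halfInt m)⁻¹ * (halfInt n)⁻¹) *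
          ((halfInt l)⁻¹ + (halfInt m)⁻¹ + (halfInt n)⁻¹) +
        π ^ 2 * ((if l = m then pairTerm l n else 0) + (if m = n then pairTerm m l else 0) +
          (if l = n then pairTerm l m else 0) -
          (if l = m ∧ m = n then (halfInt l)⁻¹ ^ 2 else 0))) := by
  have hl := halfInt_ne_zero l
  have hm := halfInt_ne_zero m
  have hn := halfInt_ne_zero n
  by_cases hlm : l = m
  · subst hlm
    by_cases hln : l = n
    · subst hln
      have h0 := hasSum_inv_int_mul_three_of_hasSum (l := l) (m := l) (n := l)
        ((hasSum_inv_int_sub_halfInt_cube l).congr_fun fun k => by ring)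
      convert h0 using 1
      simp [pairTerm]
      ring
    · have h0 := hasSum_inv_int_mul_three_of_hasSum (l := l) (m := l) (n := n)
        ((hasSum_inv_int_sub_halfInt_mul_three hln l).congr_fun fun k => by ring)
      convert h0 using 1
      have := halfInt_sub_ne_zero hln
      simp [pairTerm, hln, Ne.symm hln]
      field_simp
      ring
  · have h0 := hasSum_inv_int_mul_three_of_hasSum (hasSum_inv_int_sub_halfInt_mul_three hlm n)
    convert h0 using 1
    have h1 := halfInt_sub_ne_zero hlm
    have h2 := halfInt_sub_ne_zero (Ne.symm hlm)
    by_cases hln : l = n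
    · subst hln
      simp [pairTerm, hlm, Ne.symm hlm]
      field_simp
      ring
    · by_cases hmn : m = n
      · subst hmn
        simp [pairTerm, hlm]
        rw [← neg_sub (halfInt l) (halfInt m), inv_neg]
        field_simp
        ring
      · simp [hlm, hln, hmn]
        field_simp
        ring

lemma hasSum_mul_pow {p q : ℕ} (hp : 2 ≤ p) (hq : 2 ≤ q) :
    HasSum (fun x : ℕ × ℕ => (halfInt x.1)⁻¹ ^ p * (halfInt x.2)⁻¹ ^ q)
      (((2 ^ p - 1) * zeta p) * ((2 ^ q - 1) * zeta q)) := by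
  have h1 := hasSum_inv_halfInt_pow hp
  have h2 := hasSum_inv_halfInt_pow hq
  refine h1.mul h2 (h1.summable.mul_of_nonneg h2.summable ?_ ?_)
  all_goals intro n; have := halfInt_pos n; positivity

lemma hasSum_mul_mul_pow {p q r : ℕ} (hp : 2 ≤ p) (hq : 2 ≤ q) (hr : 2 ≤ r) :
    HasSum (fun x : ℕ × ℕ × ℕ =>
        (halfInt x.1)⁻¹ ^ p * ((halfInt x.2.1)⁻¹ ^ q * (halfInt x.2.2)⁻¹ ^ r))
      (((2 ^ p - 1) * zeta p) * (((2 ^ q - 1) * zeta q) * ((2 ^ r - 1) * zeta r))) := by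
  have h1 := hasSum_inv_halfInt_pow hp
  have h2 := hasSum_mul_pow hq hr
  refine h1.mul h2 (h1.summable.mul_of_nonneg h2.summable ?_ ?_)
  · intro n; have := halfInt_pos n; positivity
  · intro x; have := halfInt_pos x.1; have := halfInt_pos x.2; positivity

lemma one_le_abs_halfInt_sub {m n : ℕ} (hmn : m ≠ n) : 1 ≤ |halfInt m - halfInt n| := by
  have h1 : (1 : ℤ) ≤ |(m : ℤ) - n| := Int.one_le_abs (by omega)
  have h2 : halfInt m - halfInt n = (((m : ℤ) - n : ℤ) : ℝ) := by
    unfold halfInt; push_cast; ring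
  rw [h2, ← Int.cast_abs]
  exact_mod_cast h1

lemma inv_abs_halfInt_sub_le (m n : ℕ) :
    |(halfInt m - halfInt n)⁻¹| ≤ 3 * halfInt m * (halfInt n)⁻¹ := by
  have ha := half_le_halfInt m
  have hb := halfInt_pos n
  by_cases hmn : m = n
  · subst hmn; simp; positivity
  have h1 := one_le_abs_halfInt_sub hmn
  have h2 : halfInt n ≤ halfInt m + |halfInt m - halfInt n| := by
    linarith [neg_abs_le (halfInt m - halfInt n)]
  rw [abs_inv, ← div_eq_mul_inv, inv_eq_one_div, div_le_div_iff₀ (by linarith) hb]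
  nlinarith

lemma summable_pairTerm :
    Summable fun x : ℕ × ℕ => (halfInt x.1)⁻¹ ^ 2 * (halfInt x.2)⁻¹ * pairTerm x.1 x.2 := by
  refine Summable.of_norm_bounded
    ((hasSum_mul_pow (p := 2) (q := 2) le_rfl le_rfl).summable.mul_left 3) fun x => ?_
  have ha := halfInt_pos x.1
  have hb := halfInt_pos x.2
  unfold pairTerm
  rw [Real.norm_eq_abs, abs_mul, abs_mul _ (halfInt x.1 - halfInt x.2)⁻¹,
    abs_of_pos (by positivity), abs_of_pos (a := (halfInt x.1)⁻¹) (by positivity)]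
  calc _ ≤ (halfInt x.1)⁻¹ ^ 2 * (halfInt x.2)⁻¹ *
        ((halfInt x.1)⁻¹ * (3 * halfInt x.1 * (halfInt x.2)⁻¹)) := by
        gcongr
        exact inv_abs_halfInt_sub_le _ _
    _ = _ := by field_simp

lemma hasSum_diagonal :
    HasSum (fun x : ℕ × ℕ => if x.1 = x.2 then (halfInt x.1)⁻¹ ^ 5 else 0)
      ((2 ^ 5 - 1) * zeta 5) := by
  have hinj : Function.Injective fun n : ℕ => (n, n) := fun a b hab => (Prod.mk.inj hab).1
  refine (hinj.hasSum_iff ?_).mp ((hasSum_inv_halfInt_pow (m := 5) (by norm_num)).congr_fun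
    fun n => by simp)
  rintro ⟨a, b⟩ hx
  refine if_neg fun hab => hx ⟨a, ?_⟩
  simp only at hab
  rw [hab]

lemma hasSum_pairTerm :
    HasSum (fun x : ℕ × ℕ => (halfInt x.1)⁻¹ ^ 2 * (halfInt x.2)⁻¹ * pairTerm x.1 x.2)
      ((2 ^ 5 - 1) * zeta 5 - ((2 ^ 2 - 1) * zeta 2) * ((2 ^ 3 - 1) * zeta 3)) := by
  obtain ⟨S, hS⟩ := summable_pairTerm
  have hswap := (Equiv.prodComm ℕ ℕ).hasSum_iff.mpr hS
  have h1 := hS.add hswap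
  have h2 := (hasSum_diagonal.mul_left 2).sub
    ((hasSum_mul_pow (p := 2) (q := 3) (by norm_num) (by norm_num)).add
      (hasSum_mul_pow (p := 3) (q := 2) (by norm_num) (by norm_num)))
  have h3 := h1.unique (h2.congr_fun fun x => by
    obtain ⟨m, n⟩ := x
    have ha := halfInt_ne_zero m
    have hb := halfInt_ne_zero n
    simp only [Function.comp, Equiv.prodComm_apply, Prod.swap, pairTerm]
    split_ifs with hmn
    · subst hmn
      simp
      ring
    · have h1 := halfInt_sub_ne_zero hmn
      rw [← neg_sub (halfInt m) (halfInt n), inv_neg]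
      field_simp
      ring)
  rw [show (2 ^ 5 - 1) * zeta 5 - ((2 ^ 2 - 1) * zeta 2) * ((2 ^ 3 - 1) * zeta 3) = S by linarith]
  exact hS

lemma hasSum_weighted_inv_int_mul_three :
    HasSum (fun x : ℕ × ℕ × ℕ => (halfInt x.1)⁻¹ * ((halfInt x.2.1)⁻¹ * (halfInt x.2.2)⁻¹) *
      ((halfInt x.1)⁻¹ * ((halfInt x.2.1)⁻¹ * (halfInt x.2.2)⁻¹) *
          ((halfInt x.1)⁻¹ + (halfInt x.2.1)⁻¹ + (halfInt x.2.2)⁻¹) +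
        π ^ 2 * ((if x.1 = x.2.1 then pairTerm x.1 x.2.2 else 0) +
          (if x.2.1 = x.2.2 then pairTerm x.2.1 x.1 else 0) +
          (if x.1 = x.2.2 then pairTerm x.1 x.2.1 else 0) -
          (if x.1 = x.2.1 ∧ x.2.1 = x.2.2 then (halfInt x.1)⁻¹ ^ 2 else 0))))
      (372 * zeta 2 * zeta 5 - (945 / 2) * zeta 3 * zeta 4) := by
  have hd : HasSum (fun x : ℕ × ℕ × ℕ =>
      if x.1 = x.2.1 ∧ x.2.1 = x.2.2 then (halfInt x.1)⁻¹ ^ 5 else 0)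
      ((2 ^ 5 - 1) * zeta 5) := by
    have hinj : Function.Injective fun n : ℕ => (n, n, n) := fun a b hab => (Prod.mk.inj hab).1
    refine (hinj.hasSum_iff ?_).mp ((hasSum_inv_halfInt_pow (m := 5) (by norm_num)).congr_fun
      fun n => by simp)
    rintro ⟨a, b, c⟩ hx
    refine if_neg fun habc : a = b ∧ b = c => ?_
    obtain ⟨rfl, rfl⟩ := habc
    exact hx ⟨a, rfl⟩
  have h1 : HasSum (fun x : ℕ × ℕ × ℕ => if x.1 = x.2.1 then
      (halfInt x.1)⁻¹ ^ 2 * (halfInt x.2.2)⁻¹ * pairTerm x.1 x.2.2 else 0)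
      ((2 ^ 5 - 1) * zeta 5 - ((2 ^ 2 - 1) * zeta 2) * ((2 ^ 3 - 1) * zeta 3)) := by
    have hinj : Function.Injective fun y : ℕ × ℕ => (y.1, y.1, y.2) := by
      rintro ⟨a, b⟩ ⟨c, d⟩ hab
      simp_all
    refine (hinj.hasSum_iff ?_).mp (hasSum_pairTerm.congr_fun fun n => by simp)
    rintro ⟨a, b, c⟩ hx
    refine if_neg fun heq : a = b => ?_
    subst heq
    exact hx ⟨(a, c), rfl⟩
  have h2 : HasSum (fun x : ℕ × ℕ × ℕ => if x.2.1 = x.2.2 then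
      (halfInt x.2.1)⁻¹ ^ 2 * (halfInt x.1)⁻¹ * pairTerm x.2.1 x.1 else 0)
      ((2 ^ 5 - 1) * zeta 5 - ((2 ^ 2 - 1) * zeta 2) * ((2 ^ 3 - 1) * zeta 3)) := by
    have hinj : Function.Injective fun y : ℕ × ℕ => (y.2, y.1, y.1) := by
      rintro ⟨a, b⟩ ⟨c, d⟩ hab
      simp_all
    refine (hinj.hasSum_iff ?_).mp (hasSum_pairTerm.congr_fun fun n => by simp)
    rintro ⟨a, b, c⟩ hx
    refine if_neg fun heq : b = c => ?_
    subst heq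
    exact hx ⟨(b, a), rfl⟩
  have h3 : HasSum (fun x : ℕ × ℕ × ℕ => if x.1 = x.2.2 then
      (halfInt x.1)⁻¹ ^ 2 * (halfInt x.2.1)⁻¹ * pairTerm x.1 x.2.1 else 0)
      ((2 ^ 5 - 1) * zeta 5 - ((2 ^ 2 - 1) * zeta 2) * ((2 ^ 3 - 1) * zeta 3)) := by
    have hinj : Function.Injective fun y : ℕ × ℕ => (y.1, y.2, y.1) := by
      rintro ⟨a, b⟩ ⟨c, d⟩ hab
      simp_all
    refine (hinj.hasSum_iff ?_).mp (hasSum_pairTerm.congr_fun fun n => by simp)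
    rintro ⟨a, b, c⟩ hx
    refine if_neg fun heq : a = c => ?_
    subst heq
    exact hx ⟨(a, b), rfl⟩
  have hA := ((hasSum_mul_mul_pow (p := 3) (q := 2) (r := 2) (by norm_num) (by norm_num)
    (by norm_num)).add (hasSum_mul_mul_pow (p := 2) (q := 3) (r := 2) (by norm_num) (by norm_num)
    (by norm_num))).add (hasSum_mul_mul_pow (p := 2) (q := 2) (r := 3) (by norm_num) (by norm_num)
    (by norm_num))
  have hT := hA.add ((((h1.add h2).add h3).sub hd).mul_left (π ^ 2))
  convert hT using 1
  · funext ⟨a, b, c⟩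
    simp only
    by_cases hab : a = b
    · subst hab
      by_cases hac : a = c
      · subst hac; simp; ring
      · simp [hac]; ring
    · by_cases hbc : b = c
      · subst hbc; simp [hab]; ring
      · by_cases hac : a = c
        · subst hac; simp [hab, hbc]; ring
        · simp [hab, hbc, hac]; ring
  · rw [zeta_four, zeta_two]
    ring

lemma halfInt_add (j k : ℕ) : halfInt (j + k) = halfInt j + k := by
  unfold halfInt; push_cast; ring

lemma sum_inv_halfInt (k : ℕ) : ∑ i ∈ Finset.range k, (halfInt i)⁻¹ = 2 * h k := by
  rw [h, Finset.mul_sum]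
  refine Finset.sum_congr rfl fun i _ => ?_
  have : halfInt i = (2 * i + 1) / 2 := by unfold halfInt; ring
  rw [this, inv_div]
  ring

lemma tendsto_inv_halfInt : Filter.Tendsto (fun n => (halfInt n)⁻¹) Filter.atTop (nhds 0) := by
  refine Filter.Tendsto.inv_tendsto_atTop ?_
  exact Filter.tendsto_atTop_add_const_right _ _ tendsto_natCast_atTop_atTop

lemma hasSum_inv_halfInt_sub_succ (k : ℕ) :
    HasSum (fun n => (halfInt (n + k))⁻¹ - (halfInt (n + (k + 1)))⁻¹) (halfInt k)⁻¹ := by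
  rw [hasSum_iff_tendsto_nat_of_nonneg]
  · have h1 : ∀ N, ∑ n ∈ Finset.range N, ((halfInt (n + k))⁻¹ - (halfInt (n + (k + 1)))⁻¹) =
        (halfInt k)⁻¹ - (halfInt (N + k))⁻¹ := by
      intro N
      have := Finset.sum_range_sub' (fun n => (halfInt (n + k))⁻¹) N
      simp only [zero_add] at this
      rw [← this]
      refine Finset.sum_congr rfl fun n _ => ?_
      rw [show n + (k + 1) = n + 1 + k by ring]
    simp_rw [h1]
    simpa using ((Filter.tendsto_add_atTop_iff_nat k).mpr tendsto_inv_halfInt).const_sub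
      (halfInt k)⁻¹
  · intro n
    rw [← add_assoc, halfInt_add _ 1, sub_nonneg]
    have := halfInt_pos (n + k)
    gcongr
    simp

lemma hasSum_inv_halfInt_sub_add (k : ℕ) :
    HasSum (fun n => (halfInt n)⁻¹ - (halfInt (n + k))⁻¹) (2 * h k) := by
  rw [← sum_inv_halfInt]
  induction k with
  | zero => simp
  | succ k ih =>
    rw [Finset.sum_range_succ]
    exact (ih.add (hasSum_inv_halfInt_sub_succ k)).congr_fun fun n => by ring

lemma hasSum_inv_halfInt_mul_add (k : ℕ) :
    HasSum (fun n => (halfInt n)⁻¹ * (halfInt (n + (k + 1)))⁻¹) (2 * h (k + 1) / (k + 1)) := by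
  have h0 := (hasSum_inv_halfInt_sub_add (k + 1)).div_const ((k : ℝ) + 1)
  refine h0.congr_fun fun n => ?_
  have h1 := halfInt_ne_zero n
  have h2 := halfInt_ne_zero (n + (k + 1))
  have h3 : (k : ℝ) + 1 ≠ 0 := by positivity
  rw [halfInt_add] at h2 ⊢
  push_cast at h2 ⊢
  field_simp
  ring

/-- The kernel `1 / (a (k - a))` at `a = n + 1/2`; summed over `n` it gives `2 h k / k` for `k > 0`. -/
noncomputable def kernel (k : ℤ) (n : ℕ) : ℝ := (halfInt n)⁻¹ * ((k : ℝ) - halfInt n)⁻¹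

lemma kernel_neg (k n : ℕ) :
    kernel (-((k : ℤ) + 1)) n = -((halfInt n)⁻¹ * (halfInt (n + (k + 1)))⁻¹) := by
  unfold kernel
  rw [halfInt_add]
  push_cast
  rw [← mul_neg, ← inv_neg]
  ring_nf

lemma kernel_pos_add (k n : ℕ) :
    kernel ((k : ℤ) + 1) (n + (k + 1)) = -((halfInt n)⁻¹ * (halfInt (n + (k + 1)))⁻¹) := by
  unfold kernel
  rw [halfInt_add]
  push_cast
  rw [mul_comm (halfInt n)⁻¹, ← mul_neg, ← inv_neg]
  ring_nf

lemma kernel_pos_of_le {k n : ℕ} (hn : n ≤ k) :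
    kernel ((k : ℤ) + 1) n = ((halfInt n)⁻¹ + (halfInt (k - n))⁻¹) / (k + 1) := by
  have h1 := halfInt_ne_zero n
  have h2 := halfInt_ne_zero (k - n)
  have h3 : (k : ℝ) + 1 ≠ 0 := by positivity
  have h4 : (((k : ℤ) + 1 : ℤ) : ℝ) - halfInt n = halfInt (k - n) := by
    unfold halfInt; push_cast [Nat.cast_sub hn]; ring
  rw [kernel, h4]
  have h5 : (k : ℝ) + 1 = halfInt (k - n) + halfInt n := by rw [← h4]; push_cast; ring
  rw [h5] at h3 ⊢
  field_simp

lemma sum_kernel_pos (k : ℕ) :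
    ∑ n ∈ Finset.range (k + 1), kernel ((k : ℤ) + 1) n = 4 * h (k + 1) / (k + 1) := by
  have h1 : ∀ n ∈ Finset.range (k + 1), kernel ((k : ℤ) + 1) n =
      ((halfInt n)⁻¹ + (halfInt (k + 1 - 1 - n))⁻¹) / (k + 1) := fun n hn =>
    kernel_pos_of_le (Nat.lt_succ_iff.mp (Finset.mem_range.mp hn))
  rw [Finset.sum_congr rfl h1, ← Finset.sum_div, Finset.sum_add_distrib,
    Finset.sum_range_reflect (fun i => (halfInt i)⁻¹), sum_inv_halfInt]
  ring

lemma hasSum_kernel_neg (k : ℕ) :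
    HasSum (kernel (-((k : ℤ) + 1))) (-(2 * h (k + 1) / (k + 1))) :=
  (hasSum_inv_halfInt_mul_add k).neg.congr_fun fun n => kernel_neg k n

lemma hasSum_kernel_pos (k : ℕ) :
    HasSum (kernel ((k : ℤ) + 1)) (2 * h (k + 1) / (k + 1)) := by
  refine (hasSum_nat_add_iff' (k + 1)).mp ?_
  rw [sum_kernel_pos]
  have h0 := (hasSum_inv_halfInt_mul_add k).neg
  convert! h0.congr_fun fun n => kernel_pos_add k n using 1
  ring

lemma hasSum_abs_kernel_neg (k : ℕ) :
    HasSum (fun n => |kernel (-((k : ℤ) + 1)) n|) (2 * h (k + 1) / (k + 1)) := by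
  refine (hasSum_inv_halfInt_mul_add k).congr_fun fun n => ?_
  have h1 := halfInt_pos n
  have h2 := halfInt_pos (n + (k + 1))
  rw [kernel_neg, abs_neg, abs_of_pos (by positivity)]

lemma hasSum_abs_kernel_pos (k : ℕ) :
    HasSum (fun n => |kernel ((k : ℤ) + 1) n|) (6 * h (k + 1) / (k + 1)) := by
  refine (hasSum_nat_add_iff' (k + 1)).mp ?_
  have h1 : ∀ n ∈ Finset.range (k + 1), |kernel ((k : ℤ) + 1) n| = kernel ((k : ℤ) + 1) n := by
    intro n hn
    rw [kernel_pos_of_le (Nat.lt_succ_iff.mp (Finset.mem_range.mp hn))]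
    have h1 := halfInt_pos n
    have h2 := halfInt_pos (k - n)
    exact abs_of_pos (by positivity)
  rw [Finset.sum_congr rfl h1, sum_kernel_pos]
  convert! (hasSum_inv_halfInt_mul_add k).congr_fun (g := fun n =>
    |kernel ((k : ℤ) + 1) (n + (k + 1))|) fun n => ?_ using 1
  · ring
  · have h1 := halfInt_pos n
    have h2 := halfInt_pos (n + (k + 1))
    rw [kernel_pos_add, abs_neg, abs_of_pos (by positivity)]

lemma summable_abs_kernel (k : ℤ) : Summable fun n => |kernel k n| := by
  rcases lt_trichotomy k 0 with hk | hk | hk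
  · obtain ⟨j, rfl⟩ : ∃ j : ℕ, k = -((j : ℤ) + 1) := ⟨(-k - 1).toNat, by omega⟩
    exact (hasSum_abs_kernel_neg j).summable
  · subst hk
    refine (hasSum_inv_halfInt_pow (m := 2) le_rfl).summable.congr fun n => ?_
    have h1 := halfInt_pos n
    simp [kernel, abs_of_pos h1]
    ring
  · obtain ⟨j, rfl⟩ : ∃ j : ℕ, k = (j : ℤ) + 1 := ⟨(k - 1).toNat, by omega⟩
    exact (hasSum_abs_kernel_pos j).summable

lemma h_nonneg (k : ℕ) : 0 ≤ h k := Finset.sum_nonneg fun i _ => by positivity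

lemma h_succ (k : ℕ) : h (k + 1) = h k + 1 / (2 * (k : ℝ) + 1) := Finset.sum_range_succ _ _

lemma h_le (k : ℕ) : h k ≤ k := by
  induction k with
  | zero => simp [h]
  | succ k ih =>
    rw [h_succ]
    push_cast
    have : 1 / (2 * (k : ℝ) + 1) ≤ 1 := by
      rw [div_le_one (by positivity)]
      linarith [Nat.cast_nonneg (α := ℝ) k]
    linarith

lemma h_sq_le (k : ℕ) : h k ^ 2 ≤ k := by
  induction k with
  | zero => simp [h]
  | succ k ih =>
    rw [h_succ]
    push_cast
    have h0 : (0 : ℝ) ≤ k := Nat.cast_nonneg k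
    have hx : (1 / (2 * (k : ℝ) + 1)) * (2 * k + 1) = 1 := by field_simp
    have hp : 0 ≤ 1 / (2 * (k : ℝ) + 1) := by positivity
    have hle := h_le k
    generalize 1 / (2 * (k : ℝ) + 1) = x at *
    have hx1 : x ≤ 1 := by nlinarith
    have h1 : h k * x ≤ k * x := by gcongr
    nlinarith

lemma summable_h_pow_three_div :
    Summable fun k : ℕ => h (k + 1) ^ 3 / ((k : ℝ) + 1) ^ 4 := by
  refine Summable.of_nonneg_of_le (fun k => ?_) (fun k => ?_) (summable_zeta (m := 2) le_rfl)
  · have := h_nonneg (k + 1); positivity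
  · have h1 := h_sq_le (k + 1)
    have h2 := h_le (k + 1)
    have h3 := h_nonneg (k + 1)
    push_cast at h1 h2
    have hk : (0 : ℝ) < (k : ℝ) + 1 := by positivity
    rw [div_le_div_iff₀ (by positivity) (by positivity)]
    have h4 : h (k + 1) ^ 3 ≤ ((k : ℝ) + 1) ^ 2 := by
      calc h (k + 1) ^ 3 = h (k + 1) ^ 2 * h (k + 1) := by ring
        _ ≤ ((k : ℝ) + 1) * ((k : ℝ) + 1) := by gcongr
        _ = ((k : ℝ) + 1) ^ 2 := by ring
    calc _ ≤ ((k : ℝ) + 1) ^ 2 * ((k : ℝ) + 1) ^ 2 := by gcongr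
      _ = _ := by ring

lemma hasSum_mul_self_three {f : ℕ → ℝ} {s : ℝ} (hf : HasSum f s)
    (habs : Summable fun n => |f n|) :
    HasSum (fun x : ℕ × ℕ × ℕ => f x.1 * (f x.2.1 * f x.2.2)) (s * (s * s)) := by
  have h1 : Summable fun x : ℕ × ℕ => f x.1 * f x.2 :=
    summable_mul_of_summable_norm (f := f) (g := f) habs habs
  have h2 : HasSum (fun x : ℕ × ℕ => f x.1 * f x.2) (s * s) := hf.mul hf h1
  have h3 : Summable fun x : ℕ × ℕ × ℕ => f x.1 * (f x.2.1 * f x.2.2) :=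
    summable_mul_of_summable_norm (f := f) (g := fun x : ℕ × ℕ => f x.1 * f x.2) habs h1.norm
  exact hf.mul h2 h3

lemma summable_kernel_quadruple :
    Summable fun x : ℤ × ℕ × ℕ × ℕ => (x.1 : ℝ)⁻¹ *
      (kernel x.1 x.2.1 * (kernel x.1 x.2.2.1 * kernel x.1 x.2.2.2)) := by
  refine Summable.of_norm ?_
  simp only [Real.norm_eq_abs, abs_mul]
  have hfib : ∀ k : ℤ, HasSum (fun y : ℕ × ℕ × ℕ => |(k : ℝ)⁻¹| *
      (|kernel k y.1| * (|kernel k y.2.1| * |kernel k y.2.2|)))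
      (|(k : ℝ)⁻¹| * ((∑' n, |kernel k n|) * ((∑' n, |kernel k n|) * ∑' n, |kernel k n|))) := by
    intro k
    refine HasSum.mul_left _ ?_
    refine hasSum_mul_self_three (f := fun n => |kernel k n|) (summable_abs_kernel k).hasSum ?_
    simpa only [abs_abs] using summable_abs_kernel k
  refine (summable_prod_of_nonneg fun x => by positivity).mpr ⟨fun k => (hfib k).summable, ?_⟩
  simp only [fun k => (hfib k).tsum_eq]
  refine Summable.of_add_one_of_neg_add_one ?_ ?_
  · refine (summable_h_pow_three_div.mul_left 216).congr fun k => ?_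
    rw [(hasSum_abs_kernel_pos k).tsum_eq]
    push_cast
    rw [abs_inv, abs_of_pos (by positivity)]
    field_simp
    ring
  · refine (summable_h_pow_three_div.mul_left 8).congr fun k => ?_
    rw [(hasSum_abs_kernel_neg k).tsum_eq]
    push_cast
    rw [abs_inv, abs_neg, abs_of_pos (by positivity)]
    field_simp
    ring

lemma hasSum_kernel_tsum_pow_three :
    HasSum (fun k : ℤ => (k : ℝ)⁻¹ * ((∑' n, kernel k n) * ((∑' n, kernel k n) *
      ∑' n, kernel k n))) (372 * zeta 2 * zeta 5 - (945 / 2) * zeta 3 * zeta 4) := by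
  obtain ⟨S, hS⟩ := summable_kernel_quadruple
  have h1 := hS.prod_fiberwise fun k => (hasSum_mul_self_three
    (summable_abs_kernel k).of_abs.hasSum (summable_abs_kernel k)).mul_left (k : ℝ)⁻¹
  have h2 := ((Equiv.prodComm _ _).hasSum_iff.mpr hS).prod_fiberwise fun x =>
    ((hasSum_inv_int_mul_three x.1 x.2.1 x.2.2).mul_left
      ((halfInt x.1)⁻¹ * ((halfInt x.2.1)⁻¹ * (halfInt x.2.2)⁻¹))).congr_fun fun k => by
        simp only [Function.comp, Equiv.prodComm_apply, Prod.swap, kernel]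
        ring
  rwa [h2.unique hasSum_weighted_inv_int_mul_three] at h1

theorem stmt18 :
    HasSum (fun k : ℕ => (h (k + 1)) ^ 3 / ((k : ℝ) + 1) ^ 4)
      ((93 / 4) * zeta 2 * zeta 5 - (945 / 32) * zeta 3 * zeta 4) := by
  obtain ⟨S, hS⟩ := summable_h_pow_three_div
  have hpos := HasSum.of_add_one_of_neg_add_one (f := fun k : ℤ => (k : ℝ)⁻¹ *
      ((∑' n, kernel k n) * ((∑' n, kernel k n) * ∑' n, kernel k n)))
    ((hS.mul_left 8).congr_fun fun k => by
      rw [(hasSum_kernel_pos k).tsum_eq]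
      push_cast
      field_simp
      ring)
    ((hS.mul_left 8).congr_fun fun k => by
      rw [(hasSum_kernel_neg k).tsum_eq]
      push_cast
      rw [inv_neg]
      field_simp
      ring)
  have heq := hpos.unique hasSum_kernel_tsum_pow_three
  simp only [Int.cast_zero, inv_zero, zero_mul, add_zero] at heq
  rw [show (93 / 4) * zeta 2 * zeta 5 - (945 / 32) * zeta 3 * zeta 4 = S by linarith]
  exact hS
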